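/- Let m, n be integers with 0 < m < n and n odd. Let G = SL(n, ℝ) and let H = {A ∈ G : A_{ij} = 0 whenever exactly one of i, j is ≤ m, and the upper-left m×m block of A has determinant 1} (the standard block-diagonal copy of SL(m,ℝ) × SL(n−m,ℝ)). Then there is no discrete subgroup Γ of G acting properly discontinuously and cocompactly on the homogeneous space G/H; that is, SL(n,ℝ)/(SL(m,ℝ) × SL(n−m,ℝ)) admits no compact Clifford–Klein form when n is odd. -/

import Mathlib

/-!
The homogeneous space `SL(n,ℝ)/(SL(m,ℝ) × SL(n−m,ℝ))` admits no compact Clifford–Klein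
form when `n` is odd, `0 < m < n`.
-/

open Matrix

set_option maxHeartbeats 1000000
set_option synthInstance.maxHeartbeats 1000000

noncomputable section

/-- The special linear group `SL(n, ℝ)`, realized as the subgroup of `GL(n, ℝ)` of
matrices of determinant `1`; here `ℝ^n` is indexed by `Fin m ⊕ Fin (n - m)`. -/
def SLblk (m k : ℕ) : Subgroup (GL (Fin m ⊕ Fin k) ℝ) where
  carrier := {A | A.val.det = 1}
  one_mem' := by simp
  mul_mem' := by
    intro A B hA hB
    show (A * B).val.det = 1
    rw [Units.val_mul, det_mul, hA, hB, mul_one]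
  inv_mem' := by
    intro A hA
    show (A⁻¹).val.det = 1
    have h := congrArg Matrix.det (Units.mul_inv A)
    rw [det_mul, hA, one_mul] at h
    simpa using h

/-- The standard block-diagonal copy of `SL(m,ℝ) × SL(k,ℝ)` inside `SL(m+k,ℝ)`:
the subgroup of matrices whose two off-diagonal blocks vanish (i.e. `A i j = 0` whenever
exactly one of `i, j` lies in the first factor) and whose upper-left `m × m` block has
determinant `1` (the determinant of the lower-right block is then automatically `1`). -/
def SLxSL (m k : ℕ) : Subgroup ↥(SLblk m k) where
  carrier := {A | A.val.val.toBlocks₁₂ = 0 ∧ A.val.val.toBlocks₂₁ = 0 ∧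
      A.val.val.toBlocks₁₁.det = 1}
  one_mem' := by
    refine ⟨?_, ?_, ?_⟩
    · ext i j
      show (1 : Matrix (Fin m ⊕ Fin k) (Fin m ⊕ Fin k) ℝ) (Sum.inl i) (Sum.inr j) = 0
      simp [Matrix.one_apply]
    · ext i j
      show (1 : Matrix (Fin m ⊕ Fin k) (Fin m ⊕ Fin k) ℝ) (Sum.inr i) (Sum.inl j) = 0
      simp [Matrix.one_apply]
    · have h : (1 : Matrix (Fin m ⊕ Fin k) (Fin m ⊕ Fin k) ℝ).toBlocks₁₁ = 1 := by
        ext i j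
        show (1 : Matrix (Fin m ⊕ Fin k) (Fin m ⊕ Fin k) ℝ) (Sum.inl i) (Sum.inl j) = _
        simp [Matrix.one_apply, Sum.inl.injEq]
      show (1 : Matrix (Fin m ⊕ Fin k) (Fin m ⊕ Fin k) ℝ).toBlocks₁₁.det = 1
      rw [h, det_one]
  mul_mem' := by
    rintro A B ⟨hA12, hA21, hAdet⟩ ⟨hB12, hB21, hBdet⟩
    have hMA : A.val.val = Matrix.fromBlocks A.val.val.toBlocks₁₁ 0 0 A.val.val.toBlocks₂₂ := by
      conv_lhs => rw [← Matrix.fromBlocks_toBlocks A.val.val]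
      rw [hA12, hA21]
    have hMB : B.val.val = Matrix.fromBlocks B.val.val.toBlocks₁₁ 0 0 B.val.val.toBlocks₂₂ := by
      conv_lhs => rw [← Matrix.fromBlocks_toBlocks B.val.val]
      rw [hB12, hB21]
    have hprod : (A * B).val.val =
        Matrix.fromBlocks (A.val.val.toBlocks₁₁ * B.val.val.toBlocks₁₁) 0 0
          (A.val.val.toBlocks₂₂ * B.val.val.toBlocks₂₂) := by
      have h : (A * B).val.val = A.val.val * B.val.val := rfl
      rw [h, hMA, hMB, Matrix.fromBlocks_multiply]
      simp
    refine ⟨?_, ?_, ?_⟩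
    · rw [hprod, Matrix.toBlocks_fromBlocks₁₂]
    · rw [hprod, Matrix.toBlocks_fromBlocks₂₁]
    · rw [hprod, Matrix.toBlocks_fromBlocks₁₁, det_mul, hAdet, hBdet, mul_one]
  inv_mem' := by
    rintro A ⟨hA12, hA21, hAdet⟩
    set B := A.val.val.toBlocks₁₁ with hBdef
    set C := A.val.val.toBlocks₂₂ with hCdef
    have hMA : A.val.val = Matrix.fromBlocks B 0 0 C := by
      conv_lhs => rw [← Matrix.fromBlocks_toBlocks A.val.val]
      rw [hA12, hA21]
    have hdetA : A.val.val.det = 1 := A.prop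
    have hdetC : C.det = 1 := by
      have h := hdetA
      rw [hMA, Matrix.det_fromBlocks_zero₂₁, hAdet, one_mul] at h
      exact h
    have hB : B * B⁻¹ = 1 := Matrix.mul_nonsing_inv _ (by rw [hAdet]; exact isUnit_one)
    have hC : C * C⁻¹ = 1 := Matrix.mul_nonsing_inv _ (by rw [hdetC]; exact isUnit_one)
    have hAX : A.val.val * Matrix.fromBlocks B⁻¹ 0 0 C⁻¹ = 1 := by
      rw [hMA, Matrix.fromBlocks_multiply]
      simp only [Matrix.mul_zero, Matrix.zero_mul, add_zero, zero_add, hB, hC]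
      rw [Matrix.fromBlocks_one]
    have hinvA : (A⁻¹).val.val * A.val.val = 1 := by
      have h : (A⁻¹).val = (A.val)⁻¹ := rfl
      rw [h]; exact Units.inv_mul A.val
    have hX : (A⁻¹).val.val = Matrix.fromBlocks B⁻¹ 0 0 C⁻¹ := by
      calc (A⁻¹).val.val
          = (A⁻¹).val.val * (A.val.val * Matrix.fromBlocks B⁻¹ 0 0 C⁻¹) := by
            rw [hAX, Matrix.mul_one]
        _ = ((A⁻¹).val.val * A.val.val) * Matrix.fromBlocks B⁻¹ 0 0 C⁻¹ := by
            rw [Matrix.mul_assoc]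
        _ = Matrix.fromBlocks B⁻¹ 0 0 C⁻¹ := by rw [hinvA, Matrix.one_mul]
    refine ⟨?_, ?_, ?_⟩
    · rw [hX, Matrix.toBlocks_fromBlocks₁₂]
    · rw [hX, Matrix.toBlocks_fromBlocks₂₁]
    · rw [hX, Matrix.toBlocks_fromBlocks₁₁, Matrix.det_nonsing_inv, hAdet]
      simp

section General

open Set Topology

/-- If a group acts on a locally compact space with compact orbit space, then some compact set
has an interior whose translates cover the space. -/
lemma exists_isCompact_iUnion_smul_interior {Γ X : Type*} [Group Γ] [TopologicalSpace X]
    [LocallyCompactSpace X] [MulAction Γ X] [ContinuousConstSMul Γ X]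
    [CompactSpace (MulAction.orbitRel.Quotient Γ X)] :
    ∃ D : Set X, IsCompact D ∧ ∀ x : X, ∃ γ : Γ, ∃ u ∈ interior D, γ • u = x := by
  let π : X → MulAction.orbitRel.Quotient Γ X := Quotient.mk _
  have hπ : IsOpenMap π := isOpenMap_quotient_mk'_mul
  choose K hK hxK using fun x : X => exists_compact_mem_nhds x
  obtain ⟨t, ht⟩ := isCompact_univ.elim_finite_subcover (fun x => π '' interior (K x))
    (fun x => hπ _ isOpen_interior) (fun q _ => by
      obtain ⟨x, rfl⟩ := Quotient.exists_rep q
      exact mem_iUnion.2 ⟨x, x, mem_interior_iff_mem_nhds.2 (hxK x), rfl⟩)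
  refine ⟨⋃ x ∈ t, K x, t.isCompact_biUnion fun x _ => hK x, fun x => ?_⟩
  obtain ⟨y, hy, u, hu, hux⟩ : ∃ y ∈ t, ∃ u ∈ interior (K y), π u = π x := by
    simpa using ht (mem_univ (π x))
  obtain ⟨γ, hγ⟩ := Quotient.exact hux.symm
  exact ⟨γ, u, interior_mono (subset_biUnion_of_mem hy) hu, hγ⟩

/-- A space is *one-ended* if two disjoint open sets covering the complement of a compact set
cannot both fail to be relatively compact. -/
def OneEnded (X : Type*) [TopologicalSpace X] : Prop :=
  ∀ A B K : Set X, IsOpen A → IsOpen B → Disjoint A B → IsCompact K → (A ∪ B)ᶜ ⊆ K →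
    ∃ L, IsCompact L ∧ (A ⊆ L ∨ B ⊆ L)

/-- Obstruction to compact quotients: a one-ended noncompact homogeneous space `G ⧸ H` has no
compact Clifford-Klein form if there is an odd coarsely right-invariant function `f` on `G`, whose
bounded sublevel sets are at bounded distance from `H`. -/
theorem not_compactSpace_orbitRel_quotient {G : Type*} [Group G] [TopologicalSpace G]
    [IsTopologicalGroup G] (H : Subgroup G) [LocallyCompactSpace (G ⧸ H)]
    [NoncompactSpace (G ⧸ H)] (hend : OneEnded (G ⧸ H)) (f : G → ℝ)
    (hinv : ∀ g, f g⁻¹ = -f g) (hmul : ∀ h, ∃ c, ∀ g, |f (g * h) - f g| ≤ c)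
    (hbdd : ∀ M, ∃ C C' : Set G, IsCompact C ∧ IsCompact C' ∧
      ∀ g, |f g| ≤ M → ∃ c ∈ C, ∃ h ∈ H, ∃ c' ∈ C', g = c * h * c')
    (Γ : Subgroup G) [ProperlyDiscontinuousSMul Γ (G ⧸ H)] :
    ¬ CompactSpace (MulAction.orbitRel.Quotient Γ (G ⧸ H)) := by
  intro hcpt
  have : ContinuousConstSMul Γ (G ⧸ H) := ⟨fun γ => continuous_const_smul (γ : G)⟩
  obtain ⟨D, hD, hcov⟩ := exists_isCompact_iUnion_smul_interior (Γ := Γ) (X := G ⧸ H)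
  have hfin {K L : Set (G ⧸ H)} (hK : IsCompact K) (hL : IsCompact L) :
      {γ : Γ | ((γ • ·) '' K ∩ L).Nonempty}.Finite :=
    ProperlyDiscontinuousSMul.finite_disjoint_inter_image hK hL
  choose c hc using hmul
  obtain ⟨M, hM⟩ := ((hfin hD hD).image fun γ : Γ => c γ).bddAbove
  have hstep (γ γ' : Γ) (u u' : G ⧸ H) (hu : u ∈ D) (hu' : u' ∈ D) (h : γ • u = γ' • u') :
      |f γ' - f γ| ≤ M := by
    have h1 : c ((γ⁻¹ * γ' : Γ) : G) ≤ M := hM ⟨γ⁻¹ * γ', ⟨u, ⟨u', hu', by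
      simp only [mul_smul, ← h, inv_smul_smul]⟩, hu⟩, rfl⟩
    have h2 := hc ((γ⁻¹ * γ' : Γ) : G) γ
    simp only [Subgroup.coe_mul, Subgroup.coe_inv, mul_inv_cancel_left] at h1 h2
    exact h2.trans h1
  have hsmall : {γ : Γ | |f γ| ≤ M}.Finite := by
    obtain ⟨C, C', hC, hC', hCC⟩ := hbdd M
    refine (hfin ((hC'.inv).image (QuotientGroup.continuous_mk (N := H)))
      (hC.image (QuotientGroup.continuous_mk (N := H)))).subset fun γ hγ => ?_
    obtain ⟨x, hx, h, hh, y, hy, hxy⟩ := hCC γ hγ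
    refine ⟨(x : G ⧸ H), ⟨((y⁻¹ : G) : G ⧸ H), ⟨y⁻¹, by simpa using hy, rfl⟩, ?_⟩,
      ⟨x, hx, rfl⟩⟩
    change (((γ : G) * y⁻¹ : G) : G ⧸ H) = x
    rw [hxy, mul_inv_cancel_right]
    exact QuotientGroup.mk_mul_of_mem x hh
  let U (s : Set Γ) : Set (G ⧸ H) := ⋃ γ ∈ s, (γ • ·) '' interior D
  have hUo (s : Set Γ) : IsOpen (U s) :=
    isOpen_biUnion fun γ _ => (isOpenMap_smul γ) _ isOpen_interior
  have hUfin (s : Set Γ) {L : Set (G ⧸ H)} (hL : IsCompact L) (hs : U s ⊆ L) : s.Finite := by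
    refine (hfin hD hL).subset fun γ hγ => ?_
    obtain ⟨_, u, hu, _⟩ := hcov ((1 : G) : G ⧸ H)
    exact ⟨γ • u, ⟨u, interior_subset hu, rfl⟩, hs (mem_biUnion hγ ⟨u, hu, rfl⟩)⟩
  let P : Set Γ := {γ | M < f γ}
  let N : Set Γ := {γ | f γ < -M}
  have hPN : P.Finite ↔ N.Finite := by
    have : N = P⁻¹ := by
      ext γ
      simp only [N, P, mem_ofPred_eq, mem_inv, Subgroup.coe_inv, hinv]
      exact lt_neg
    rw [this, Set.finite_inv]
  have hcompact (s : Set Γ) (hs : s.Finite) : IsCompact (⋃ γ ∈ s, (γ • ·) '' D) :=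
    hs.isCompact_biUnion fun γ _ => hD.image (continuous_const_smul γ)
  have hall : P.Finite := by
    have hdisj : Disjoint (U P) (U N) := by
      rw [Set.disjoint_left]
      intro x hx hx'
      simp only [U, mem_iUnion, mem_image] at hx hx'
      obtain ⟨γ, hγ, u, hu, rfl⟩ := hx
      obtain ⟨γ', hγ', u', hu', hxx⟩ := hx'
      have := hstep γ' γ u' u (interior_subset hu') (interior_subset hu) hxx
      have hγ : M < f γ := hγ
      have hγ' : f γ' < -M := hγ'
      have h0 : 0 ≤ M := (abs_nonneg _).trans this
      linarith [(abs_le.1 this).2]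
    have hcompl : (U P ∪ U N)ᶜ ⊆ ⋃ γ ∈ {γ : Γ | |f γ| ≤ M}, (γ • ·) '' D := by
      intro x hx
      obtain ⟨γ, u, hu, rfl⟩ := hcov x
      refine mem_biUnion (x := γ) ?_ ⟨u, interior_subset hu, rfl⟩
      by_contra hγ
      have hγ : ¬ |f (γ : G)| ≤ M := hγ
      apply hx
      rcases lt_abs.1 (not_le.1 hγ) with h | h
      · exact Or.inl (mem_biUnion (show γ ∈ P from h) ⟨u, hu, rfl⟩)
      · exact Or.inr (mem_biUnion (show γ ∈ N from lt_neg.1 h) ⟨u, hu, rfl⟩)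
    obtain ⟨L, hL, h | h⟩ := hend _ _ _ (hUo P) (hUo N) hdisj (hcompact _ hsmall) hcompl
    · exact hUfin _ hL h
    · exact hPN.2 (hUfin _ hL h)
  have huniv : (univ : Set Γ).Finite := by
    refine ((hall.union (hPN.1 hall)).union hsmall).subset fun γ _ => ?_
    by_cases h : |f γ| ≤ M
    · exact Or.inr h
    · rcases lt_abs.1 (not_le.1 h) with h | h
      · exact Or.inl (Or.inl h)
      · exact Or.inl (Or.inr (lt_neg.1 h))
  refine noncompact_univ (G ⧸ H) ((hcompact _ huniv).of_isClosed_subset isClosed_univ fun x _ => ?_)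
  obtain ⟨γ, u, hu, rfl⟩ := hcov x
  exact mem_biUnion (mem_univ γ) ⟨u, interior_subset hu, rfl⟩

end General

section Orthogonal

open Set Topology

variable {ι : Type*} [Fintype ι] [DecidableEq ι]

lemma coe_mul_coe_inv (k : SpecialLinearGroup ι ℝ) :
    (k : Matrix ι ι ℝ) * ((k⁻¹ : SpecialLinearGroup ι ℝ) : Matrix ι ι ℝ) = 1 :=
  congrArg Subtype.val (mul_inv_cancel k)

/-- The special orthogonal group, as a subset of the special linear group. -/
def specialOrthogonalSet (ι : Type*) [Fintype ι] [DecidableEq ι] :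
    Set (SpecialLinearGroup ι ℝ) := {k | (k : Matrix ι ι ℝ)ᵀ * (k : Matrix ι ι ℝ) = 1}

lemma abs_apply_le_one_of_mem_specialOrthogonalSet {k : SpecialLinearGroup ι ℝ}
    (hk : k ∈ specialOrthogonalSet ι) (i j : ι) : |(k : Matrix ι ι ℝ) i j| ≤ 1 := by
  have hU : (k : Matrix ι ι ℝ) ∈ unitaryGroup ι ℝ := mem_unitaryGroup_iff'.2 (by
    rw [star_eq_conjTranspose, conjTranspose_eq_transpose_of_trivial]; exact hk)
  exact entry_norm_bound_of_unitary hU i j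

lemma isCompact_specialOrthogonalSet : IsCompact (specialOrthogonalSet ι) := by
  have hc : IsCompact {M : Matrix ι ι ℝ | Mᵀ * M = 1 ∧ ∀ i j, M i j ∈ Icc (-1) (1 : ℝ)} := by
    refine IsCompact.of_isClosed_subset (isCompact_univ_pi fun _ : ι => isCompact_univ_pi
      fun _ : ι => isCompact_Icc (a := (-1 : ℝ)) (b := 1)) ?_ fun M hM i _ j _ => hM.2 i j
    refine (isClosed_eq (by fun_prop) continuous_const).inter ?_
    have : {M : Matrix ι ι ℝ | ∀ i j, M i j ∈ Icc (-1) (1 : ℝ)} =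
        ⋂ i, ⋂ j, (fun M : Matrix ι ι ℝ => M i j) ⁻¹' Icc (-1) 1 := by
      ext M; simp
    have hclosed : IsClosed {M : Matrix ι ι ℝ | ∀ i j, M i j ∈ Icc (-1) (1 : ℝ)} :=
      this ▸ isClosed_iInter fun i => isClosed_iInter fun j => isClosed_Icc.preimage (by fun_prop)
    exact hclosed
  refine (SpecialLinearGroup.isClosedEmbedding_val.isCompact_preimage hc).of_isClosed_subset
    ?_ fun k hk => ⟨hk, fun i j => abs_le.1 (abs_apply_le_one_of_mem_specialOrthogonalSet hk i j)⟩
  exact isClosed_eq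
    (f := fun k : SpecialLinearGroup ι ℝ => (k : Matrix ι ι ℝ)ᵀ * (k : Matrix ι ι ℝ))
    (by have : Continuous fun k : SpecialLinearGroup ι ℝ => (k : Matrix ι ι ℝ) :=
          continuous_subtype_val
        fun_prop) continuous_const

lemma inv_mem_specialOrthogonalSet {k : SpecialLinearGroup ι ℝ}
    (hk : k ∈ specialOrthogonalSet ι) : k⁻¹ ∈ specialOrthogonalSet ι := by
  have h : ((k⁻¹ : SpecialLinearGroup ι ℝ) : Matrix ι ι ℝ) = (k : Matrix ι ι ℝ)ᵀ := by
    have h1 : (k : Matrix ι ι ℝ) * ((k⁻¹ : SpecialLinearGroup ι ℝ) : Matrix ι ι ℝ) = 1 :=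
      coe_mul_coe_inv _
    calc ((k⁻¹ : SpecialLinearGroup ι ℝ) : Matrix ι ι ℝ)
        = ((k : Matrix ι ι ℝ)ᵀ * (k : Matrix ι ι ℝ)) *
          ((k⁻¹ : SpecialLinearGroup ι ℝ) : Matrix ι ι ℝ) := by
          rw [show (k : Matrix ι ι ℝ)ᵀ * (k : Matrix ι ι ℝ) = 1 from hk, Matrix.one_mul]
      _ = (k : Matrix ι ι ℝ)ᵀ := by rw [Matrix.mul_assoc, h1, Matrix.mul_one]
  change ((k⁻¹ : SpecialLinearGroup ι ℝ) : Matrix ι ι ℝ)ᵀ *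
    ((k⁻¹ : SpecialLinearGroup ι ℝ) : Matrix ι ι ℝ) = 1
  rw [h, transpose_transpose]
  exact mul_eq_one_comm.1 hk

lemma mul_mem_specialOrthogonalSet {k l : SpecialLinearGroup ι ℝ}
    (hk : k ∈ specialOrthogonalSet ι) (hl : l ∈ specialOrthogonalSet ι) :
    k * l ∈ specialOrthogonalSet ι := by
  change ((k : Matrix ι ι ℝ) * (l : Matrix ι ι ℝ))ᵀ * ((k : Matrix ι ι ℝ) * (l : Matrix ι ι ℝ)) = 1
  rw [transpose_mul, Matrix.mul_assoc, ← Matrix.mul_assoc (k : Matrix ι ι ℝ)ᵀ,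
    show (k : Matrix ι ι ℝ)ᵀ * (k : Matrix ι ι ℝ) = 1 from hk,
    Matrix.one_mul]
  exact hl

lemma exists_transpose_mul_self_eq {S : Matrix ι ι ℝ} (hS : S.PosSemidef) (hdet : S.det ≠ 0) :
    ∃ Y : Matrix ι ι ℝ, Yᵀ * Y = S ∧ 0 < Y.det := by
  obtain ⟨Y, hY⟩ : ∃ Y : Matrix ι ι ℝ, Yᵀ * Y = S := by
    open scoped MatrixOrder in
    obtain ⟨Y, hY⟩ := CStarAlgebra.nonneg_iff_eq_star_mul_self.1 hS.nonneg
    exact ⟨Y, by rw [hY, star_eq_conjTranspose, conjTranspose_eq_transpose_of_trivial]⟩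
  have hY0 : Y.det ≠ 0 := by
    rintro h
    rw [← hY, det_mul, h, mul_zero] at hdet
    exact hdet rfl
  rcases hY0.lt_or_gt with h | h
  · rcases isEmpty_or_nonempty ι with hι | ⟨⟨i⟩⟩
    · simp at h; linarith
    · refine ⟨diagonal (Function.update 1 i (-1)) * Y, ?_, ?_⟩
      · have : diagonal (Function.update (1 : ι → ℝ) i (-1)) *
            diagonal (Function.update (1 : ι → ℝ) i (-1)) = 1 := by
          rw [diagonal_mul_diagonal, ← diagonal_one]
          congr 1
          ext j
          by_cases hj : j = i
          · subst hj; simp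
          · simp [hj]
        rw [transpose_mul, diagonal_transpose, Matrix.mul_assoc, ← Matrix.mul_assoc (diagonal _),
          this, Matrix.one_mul, hY]
      · rw [det_mul, det_diagonal, Finset.prod_update_of_mem (Finset.mem_univ i)]
        simpa using h
  · exact ⟨Y, hY, h⟩

lemma posDef_transpose_mul_self (g : SpecialLinearGroup ι ℝ) :
    ((g : Matrix ι ι ℝ)ᵀ * (g : Matrix ι ι ℝ)).PosDef := by
  have := PosDef.conjTranspose_mul_self (g : Matrix ι ι ℝ)
    (mulVec_injective_of_isUnit ((isUnit_iff_isUnit_det _).2 (by rw [g.2]; exact isUnit_one)))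
  rwa [conjTranspose_eq_transpose_of_trivial] at this

/-- If `R` has positive determinant and `Rᵀ * R = gᵀ * g`, then `g ∈ SO * R`. -/
lemma exists_mem_specialOrthogonalSet_mul {g : SpecialLinearGroup ι ℝ} {R : Matrix ι ι ℝ}
    (hR : 0 < R.det) (h : Rᵀ * R = (g : Matrix ι ι ℝ)ᵀ * (g : Matrix ι ι ℝ)) :
    R.det = 1 ∧ ∃ k ∈ specialOrthogonalSet ι, (g : Matrix ι ι ℝ) = (k : Matrix ι ι ℝ) * R := by
  have hdet : R.det = 1 := by
    have := congrArg Matrix.det h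
    rw [det_mul, det_mul, det_transpose, det_transpose, g.2, mul_one] at this
    nlinarith
  let r : SpecialLinearGroup ι ℝ := ⟨R, hdet⟩
  refine ⟨hdet, g * r⁻¹, ?_, ?_⟩
  · have hr : (r : Matrix ι ι ℝ) * ((r⁻¹ : SpecialLinearGroup ι ℝ) : Matrix ι ι ℝ) = 1 :=
      coe_mul_coe_inv _
    change ((g : Matrix ι ι ℝ) * ((r⁻¹ : SpecialLinearGroup ι ℝ) : Matrix ι ι ℝ))ᵀ *
      ((g : Matrix ι ι ℝ) * ((r⁻¹ : SpecialLinearGroup ι ℝ) : Matrix ι ι ℝ)) = 1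
    rw [transpose_mul, Matrix.mul_assoc, ← Matrix.mul_assoc (g : Matrix ι ι ℝ)ᵀ, ← h,
      Matrix.mul_assoc,
      show R * ((r⁻¹ : SpecialLinearGroup ι ℝ) : Matrix ι ι ℝ) = 1 from hr, Matrix.mul_one,
      ← transpose_mul, show R * ((r⁻¹ : SpecialLinearGroup ι ℝ) : Matrix ι ι ℝ) = 1 from hr,
      transpose_one]
  · exact congrArg Subtype.val (inv_mul_cancel_right g r).symm

/-- Singular value decomposition in odd-dimensional special linear groups. -/
lemma exists_singular_value_decomposition (hodd : Odd (Fintype.card ι))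
    (g : SpecialLinearGroup ι ℝ) :
    ∃ k ∈ specialOrthogonalSet ι, ∃ l ∈ specialOrthogonalSet ι, ∃ x : ι → ℝ,
      ∑ i, x i = 0 ∧ (g : Matrix ι ι ℝ) =
        (k : Matrix ι ι ℝ) * diagonal (fun i => Real.exp (x i)) * (l : Matrix ι ι ℝ) := by
  obtain ⟨b, hpos, U, hU, hUS⟩ : ∃ b : ι → ℝ, (∀ i, 0 < b i) ∧ ∃ U ∈ specialOrthogonalSet ι,
      (g : Matrix ι ι ℝ)ᵀ * (g : Matrix ι ι ℝ) =
        (U : Matrix ι ι ℝ) * diagonal b * (U : Matrix ι ι ℝ)ᵀ := by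
    have hS := posDef_transpose_mul_self g
    refine ⟨hS.1.eigenvalues, hS.eigenvalues_pos, ?_⟩
    have h := hS.1.spectral_theorem
    rw [Unitary.conjStarAlgAut_apply, star_eq_conjTranspose,
      conjTranspose_eq_transpose_of_trivial] at h
    have hV : (hS.1.eigenvectorUnitary : Matrix ι ι ℝ)ᵀ * hS.1.eigenvectorUnitary = 1 := by
      have := (hS.1.eigenvectorUnitary).2.1
      rwa [star_eq_conjTranspose, conjTranspose_eq_transpose_of_trivial] at this
    generalize (hS.1.eigenvectorUnitary : Matrix ι ι ℝ) = V at h hV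
    have hd : V.det * V.det = 1 := by
      have := congrArg Matrix.det hV
      rwa [det_mul, det_transpose, det_one] at this
    rcases mul_self_eq_one_iff.1 hd with h1 | h1
    · exact ⟨⟨V, h1⟩, hV, h⟩
    · refine ⟨⟨-V, ?_⟩, ?_, ?_⟩
      · rw [det_neg, hodd.neg_one_pow, h1]; norm_num
      · change (-V)ᵀ * (-V) = 1
        simpa using hV
      · simpa using h
  set a : ι → ℝ := fun i => Real.exp (Real.log (b i) / 2) with ha
  have haa : diagonal a * diagonal a = diagonal b := by
    rw [diagonal_mul_diagonal]
    congr 1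
    ext i
    rw [ha, ← Real.exp_add, add_halves, Real.exp_log (hpos i)]
  obtain ⟨hdet, k, hk, hg⟩ := exists_mem_specialOrthogonalSet_mul (g := g)
    (R := diagonal a * (U : Matrix ι ι ℝ)ᵀ) (by
      rw [det_mul, det_transpose, U.2, mul_one, det_diagonal]
      exact Finset.prod_pos fun i _ => Real.exp_pos _) (by
      rw [transpose_mul, transpose_transpose, diagonal_transpose, Matrix.mul_assoc,
        ← Matrix.mul_assoc (diagonal a), haa, hUS, Matrix.mul_assoc])
  refine ⟨k, hk, U⁻¹, inv_mem_specialOrthogonalSet hU,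
    fun i => Real.log (b i) / 2, ?_, ?_⟩
  · rw [det_mul, det_transpose, U.2, mul_one, det_diagonal, ha, ← Real.exp_sum,
      Real.exp_eq_one_iff] at hdet
    exact hdet
  · rw [hg, Matrix.mul_assoc]
    congr 2
    calc (U : Matrix ι ι ℝ)ᵀ = (U : Matrix ι ι ℝ)ᵀ *
        ((U : Matrix ι ι ℝ) * ((U⁻¹ : SpecialLinearGroup ι ℝ) : Matrix ι ι ℝ)) := by
          rw [coe_mul_coe_inv, Matrix.mul_one]
      _ = _ := by rw [← Matrix.mul_assoc,
        show (U : Matrix ι ι ℝ)ᵀ * (U : Matrix ι ι ℝ) = 1 from hU, Matrix.one_mul]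

/-- Coordinates can be permuted by elements of the special orthogonal group in odd dimension. -/
lemma exists_mul_diagonal_comp_perm (hodd : Odd (Fintype.card ι)) (σ : Equiv.Perm ι) :
    ∃ k ∈ specialOrthogonalSet ι, ∀ d : ι → ℝ,
      diagonal d = (k : Matrix ι ι ℝ) * diagonal (d ∘ σ) *
        ((k⁻¹ : SpecialLinearGroup ι ℝ) : Matrix ι ι ℝ) := by
  obtain ⟨k, hk, hd⟩ : ∃ k ∈ specialOrthogonalSet ι, ∀ d : ι → ℝ,
      diagonal d * (k : Matrix ι ι ℝ) = (k : Matrix ι ι ℝ) * diagonal (d ∘ σ) := by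
    have hσ : (σ⁻¹.permMatrix ℝ).det * (σ⁻¹.permMatrix ℝ).det = 1 := by
      rw [det_permutation]
      rcases Int.units_eq_one_or (Equiv.Perm.sign σ⁻¹) with h | h <;> simp [h]
    have horth : (σ⁻¹.permMatrix ℝ)ᵀ * σ⁻¹.permMatrix ℝ = 1 := by
      rw [transpose_permMatrix, ← permMatrix_mul]; simp
    have hcomm (d : ι → ℝ) :
        diagonal d * σ⁻¹.permMatrix ℝ = σ⁻¹.permMatrix ℝ * diagonal (d ∘ σ) := by
      ext i j
      rw [diagonal_mul, mul_diagonal]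
      by_cases h : σ⁻¹ i = j
      · subst h; simp
      · have h' : ¬ σ.symm i = j := h
        simp [PEquiv.toMatrix_apply, Equiv.Perm.permMatrix, h']
    rcases mul_self_eq_one_iff.1 hσ with h1 | h1
    · exact ⟨⟨_, h1⟩, horth, hcomm⟩
    · refine ⟨⟨-σ⁻¹.permMatrix ℝ, ?_⟩, ?_, fun d => ?_⟩
      · rw [det_neg, hodd.neg_one_pow, h1]; norm_num
      · change (-_)ᵀ * (-_) = 1
        simpa using horth
      · simpa using hcomm d
  refine ⟨k, hk, fun d => ?_⟩
  rw [← hd, Matrix.mul_assoc, coe_mul_coe_inv, Matrix.mul_one]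

end Orthogonal

section PathConnected

open Set Topology

variable {ι : Type*} [Fintype ι] [DecidableEq ι]

lemma joined_one_transvection {i j : ι} (hij : i ≠ j) (b : ℝ) :
    Joined 1 (SpecialLinearGroup.transvection hij b) := by
  have hc : Continuous fun t : ℝ => SpecialLinearGroup.transvection hij t := by
    refine continuous_induced_rng.2 ?_
    change Continuous fun t : ℝ => 1 + single i j t
    refine continuous_const.add (continuous_matrix fun r c => ?_)
    simp only [single_apply]
    split_ifs <;> fun_prop
  simpa using (PathConnectedSpace.joined (0 : ℝ) b).map hc

lemma diag2n_eq_prod_transvection {F : Type*} [Field F] {i j : ι} (hij : i ≠ j) {a : F}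
    (ha : a ≠ 0) : SpecialLinearGroup.diag2n hij a ha =
      SpecialLinearGroup.transvection hij a * SpecialLinearGroup.transvection hij.symm (-a⁻¹) *
      SpecialLinearGroup.transvection hij a * SpecialLinearGroup.transvection hij (-1) *
      SpecialLinearGroup.transvection hij.symm 1 * SpecialLinearGroup.transvection hij (-1) := by
  apply SpecialLinearGroup.coeMonoidHom_injective
  rw [← one_mul (SpecialLinearGroup.transvection hij a * _ * _ * _ * _ * _)]
  simp only [← mul_assoc, map_mul, map_one]
  change diagonal (fun k => if k = i then a else if k = j then a⁻¹ else 1) =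
    1 * transvection i j a * transvection j i (-a⁻¹) * transvection i j a *
    transvection i j (-1) * transvection j i 1 * transvection i j (-1)
  ext r c
  rw [diagonal_apply]
  have hentry (r c : ι) : transvection i j a r c =
      (if r = c then 1 else 0) + if i = r ∧ j = c then a else 0 := by
    simp [transvection, single_apply, one_apply]
  rcases eq_or_ne c j with rfl | hj
  · simp only [one_mul, mul_transvection_apply_same, mul_transvection_apply_of_ne, ne_eq, hij,
      hij.symm, not_false_iff, hentry]
    grind
  rcases eq_or_ne c i with rfl | hi
  · simp only [one_mul, mul_transvection_apply_same, mul_transvection_apply_of_ne, ne_eq, hij,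
      hij.symm, not_false_iff, hentry]
    grind
  · simp only [one_mul, mul_transvection_apply_of_ne, ne_eq, hj, hi, not_false_iff, hentry]
    grind

instance : PathConnectedSpace (SpecialLinearGroup ι ℝ) := by
  have h1 (g : SpecialLinearGroup ι ℝ) : Joined 1 g := by
    rcases subsingleton_or_nontrivial ι with h | h
    · rw [Subsingleton.elim g 1]
    have hmul (g h : SpecialLinearGroup ι ℝ) (hg : Joined 1 g) (hh : Joined 1 h) :
        Joined 1 (g * h) := by simpa using hg.mul hh
    refine SpecialLinearGroup.diagonal_transvection_induction' (Joined 1) g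
      (fun i j hij a ha => ?_) (fun i j hij a => joined_one_transvection hij a) hmul
    rw [diag2n_eq_prod_transvection hij ha]
    exact hmul _ _ (hmul _ _ (hmul _ _ (hmul _ _ (hmul _ _ (joined_one_transvection _ _)
      (joined_one_transvection _ _)) (joined_one_transvection _ _)) (joined_one_transvection _ _))
      (joined_one_transvection _ _)) (joined_one_transvection _ _)
  exact ⟨⟨1⟩, fun g h => (h1 g).symm.trans (h1 h)⟩

end PathConnected

section Ends

open Set Topology

variable {E : Type*} [NormedAddCommGroup E] [NormedSpace ℝ E]

lemma isPreconnected_setOf_lt_norm (hE : 1 < Module.rank ℝ E) {R : ℝ} (hR : 0 ≤ R) :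
    IsPreconnected {e : E | R < ‖e‖} := by
  have : {e : E | R < ‖e‖} = (fun p : ℝ × E => p.1 • p.2) '' (Ioi R ×ˢ Metric.sphere 0 1) := by
    ext e
    constructor
    · intro he
      have h0 : ‖e‖ ≠ 0 := (hR.trans_lt he).ne'
      exact ⟨(‖e‖, ‖e‖⁻¹ • e), ⟨he, by simp [norm_smul, h0]⟩, by simp [smul_smul, h0]⟩
    · rintro ⟨⟨r, u⟩, ⟨hr, hu⟩, rfl⟩
      have hr : R < r := hr
      have hu : ‖u‖ = 1 := by simpa using hu
      change R < ‖r • u‖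
      rwa [norm_smul, hu, mul_one, Real.norm_of_nonneg (hR.trans hr.le)]
  rw [this]
  exact (isPreconnected_Ioi.prod (isPathConnected_sphere hE 0 zero_le_one).isConnected.2).image _
    (by fun_prop)

variable {G : Type*} [Group G] [TopologicalSpace G] (H : Subgroup G) (n : E → G) (ψ : G ⧸ H → E)

lemma noncompactSpace_quotient [Nontrivial E] (hψ : Continuous ψ)
    (hψn : ∀ e, ψ (n e : G ⧸ H) = e) : NoncompactSpace (G ⧸ H) := by
  refine not_compactSpace_iff.1 fun h => ?_
  have := NormedSpace.noncompactSpace ℝ E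
  refine noncompact_univ E ?_
  rw [← (Function.LeftInverse.surjective hψn).range_eq]
  exact isCompact_range hψ

/-- A homogeneous space `G ⧸ H` of a path connected group is one-ended if `G = K n(E) H`, where
`K` is compact and `n(E)` is a section over a normed space of dimension at least two. -/
lemma oneEnded_quotient [ProperSpace E] [IsTopologicalGroup G] [PathConnectedSpace G]
    (hE : 1 < Module.rank ℝ E) {K : Set G} (hK : IsCompact K) (h1 : 1 ∈ K) (hn : Continuous n)
    (hψ : Continuous ψ)
    (hψn : ∀ e, ψ (n e : G ⧸ H) = e) (hdec : ∀ g, ∃ κ ∈ K, ∃ e, ∃ h ∈ H, g = κ * n e * h) :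
    OneEnded (G ⧸ H) := by
  intro A B K₀ hA hB hAB hK₀ hABK
  have : Nontrivial E := (rank_pos_iff_nontrivial (R := ℝ)).1 (zero_lt_one.trans hE)
  have hn' : Continuous fun p : G × E => p.1 • (n p.2 : G ⧸ H) :=
    QuotientGroup.continuous_mk.comp (continuous_fst.mul (hn.comp continuous_snd))
  have hescape (C : Set G) (hC : IsCompact C) :
      ∃ R, 0 ≤ R ∧ ∀ e, R < ‖e‖ → ∀ c ∈ C, c • (n e : G ⧸ H) ∈ A ∪ B := by
    have hD : IsCompact ((fun p : G × (G ⧸ H) => p.1⁻¹ • p.2) '' (C ×ˢ K₀)) :=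
      (hC.prod hK₀).image (by fun_prop)
    obtain ⟨R, hR⟩ := (hD.image hψ).isBounded.subset_closedBall 0
    refine ⟨max R 0, le_max_right _ _, fun e he c hc => ?_⟩
    by_contra h
    have : ψ (n e) ∈ Metric.closedBall 0 R :=
      hR ⟨_, ⟨(c, c • (n e : G ⧸ H)), ⟨hc, hABK h⟩, inv_smul_smul _ _⟩, rfl⟩
    rw [hψn, mem_closedBall_zero_iff] at this
    exact (this.trans (le_max_left _ _)).not_gt he
  obtain ⟨R, hR0, hR⟩ := hescape K hK
  have key (A B : Set (G ⧸ H)) (hA : IsOpen A) (hB : IsOpen B) (hAB : Disjoint A B)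
      (hescape : ∀ C : Set G, IsCompact C →
        ∃ R, 0 ≤ R ∧ ∀ e, R < ‖e‖ → ∀ c ∈ C, c • (n e : G ⧸ H) ∈ A ∪ B)
      (hR : ∀ e, R < ‖e‖ → ∀ c ∈ K, c • (n e : G ⧸ H) ∈ A ∪ B)
      (hS : (fun e => (1 : G) • (n e : G ⧸ H)) '' {e | R < ‖e‖} ⊆ A) :
      ∃ L, IsCompact L ∧ B ⊆ L := by
    refine ⟨_, (hK.prod (isCompact_closedBall (0 : E) R)).image hn', fun x hx => ?_⟩
    obtain ⟨g, rfl⟩ := QuotientGroup.mk_surjective x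
    obtain ⟨κ, hκ, e, h, hh, rfl⟩ := hdec g
    rw [QuotientGroup.mk_mul_of_mem _ hh] at hx ⊢
    refine ⟨(κ, e), ⟨hκ, mem_closedBall_zero_iff.2 (not_lt.1 fun he => ?_)⟩, rfl⟩
    have hpre := (isPreconnected_setOf_lt_norm hE hR0).image
      (fun e => κ • (n e : G ⧸ H)) (hn'.comp (.prodMk_right κ)).continuousOn
    rcases hpre.subset_or_subset hA hB hAB (by rintro _ ⟨e, he, rfl⟩; exact hR e he κ hκ)
      with hκA | hκB
    · exact hAB.notMem_of_mem_left (hκA ⟨e, he, rfl⟩) hx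
    let γ := PathConnectedSpace.somePath 1 κ
    obtain ⟨R', -, hR'⟩ := hescape _ (isCompact_range γ.continuous)
    obtain ⟨e', he'⟩ := NormedSpace.exists_lt_norm ℝ E (max R R')
    have hpre' := (isPreconnected_range γ.continuous).image
      (fun c => c • (n e' : G ⧸ H)) (hn'.comp (.prodMk_left e')).continuousOn
    have hsrc : (1 : G) • (n e' : G ⧸ H) ∈ A := hS ⟨e', (le_max_left _ _).trans_lt he', rfl⟩
    have htgt : κ • (n e' : G ⧸ H) ∈ B := hκB ⟨e', (le_max_left _ _).trans_lt he', rfl⟩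
    rcases hpre'.subset_or_subset hA hB hAB
      (by rintro _ ⟨c, hc, rfl⟩; exact hR' e' ((le_max_right _ _).trans_lt he') c hc)
      with hγ | hγ
    · exact hAB.notMem_of_mem_left (hγ ⟨κ, ⟨1, γ.target⟩, rfl⟩) htgt
    · exact hAB.notMem_of_mem_left hsrc (hγ ⟨1, ⟨0, γ.source⟩, rfl⟩)
  have hpre := (isPreconnected_setOf_lt_norm hE hR0).image
    (fun e => (1 : G) • (n e : G ⧸ H)) (hn'.comp (.prodMk_right 1)).continuousOn
  rcases hpre.subset_or_subset hA hB hAB (by rintro _ ⟨e, he, rfl⟩; exact hR e he 1 h1) with hS | hS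
  · obtain ⟨L, hL, hBL⟩ := key A B hA hB hAB hescape hR hS
    exact ⟨L, hL, .inr hBL⟩
  · obtain ⟨L, hL, hAL⟩ := key B A hB hA hAB.symm (by simpa only [union_comm] using hescape)
      (by simpa only [union_comm] using hR) hS
    exact ⟨L, hL, .inl hAL⟩

end Ends

section Blocks

open Set Topology

variable {α β : Type*} [Fintype α] [DecidableEq α] [Fintype β] [DecidableEq β]

/-- The block-diagonal copy of `SL α × SL β` in `SL (α ⊕ β)`. -/
def blockDiagonalSet (α β : Type*) [Fintype α] [DecidableEq α] [Fintype β] [DecidableEq β] :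
    Set (SpecialLinearGroup (α ⊕ β) ℝ) :=
  {h | (h : Matrix (α ⊕ β) (α ⊕ β) ℝ).toBlocks₁₂ = 0 ∧
    (h : Matrix (α ⊕ β) (α ⊕ β) ℝ).toBlocks₂₁ = 0 ∧
    (h : Matrix (α ⊕ β) (α ⊕ β) ℝ).toBlocks₁₁.det = 1}

lemma det_fromBlocks_exp (B : Matrix α β ℝ) (t : ℝ) :
    (fromBlocks (Real.exp (Fintype.card β * t) • 1) (Real.exp (-(Fintype.card α * t)) • B) 0
      (Real.exp (-(Fintype.card α * t)) • 1)).det = 1 := by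
  rw [det_fromBlocks_zero₂₁, det_smul, det_smul, det_one, det_one, ← Real.exp_nat_mul,
    ← Real.exp_nat_mul, mul_one, mul_one, ← Real.exp_add, Real.exp_eq_one_iff]
  ring

/-- The solvable section of `SL (α ⊕ β) → SL (α ⊕ β) / (SL α × SL β)` modulo the special orthogonal
group: a block-unipotent matrix times a block-scalar one. -/
def unipotentMulScalar (e : (α → β → ℝ) × ℝ) : SpecialLinearGroup (α ⊕ β) ℝ :=
  ⟨_, det_fromBlocks_exp (of e.1) e.2⟩

lemma continuous_unipotentMulScalar :
    Continuous (unipotentMulScalar : (α → β → ℝ) × ℝ → SpecialLinearGroup (α ⊕ β) ℝ) := by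
  refine continuous_induced_rng.2 ?_
  change Continuous fun e : (α → β → ℝ) × ℝ => fromBlocks (Real.exp (Fintype.card β * e.2) • 1)
    (Real.exp (-(Fintype.card α * e.2)) • of e.1) 0 (Real.exp (-(Fintype.card α * e.2)) • 1)
  have : Continuous fun e : (α → β → ℝ) × ℝ => of e.1 := continuous_fst
  exact Continuous.matrix_fromBlocks (by fun_prop) (by fun_prop) continuous_const (by fun_prop)

lemma exists_fromBlocks_zero_eq [Nonempty α] [Nonempty β] {g : SpecialLinearGroup (α ⊕ β) ℝ}
    {Y : Matrix α α ℝ} {C : Matrix α β ℝ} {Z : Matrix β β ℝ}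
    (hg : (g : Matrix (α ⊕ β) (α ⊕ β) ℝ) = fromBlocks Y C 0 Z) (hY : 0 < Y.det) :
    ∃ e, ∃ h ∈ blockDiagonalSet α β, g = unipotentMulScalar e * h := by
  have hdet : Y.det * Z.det = 1 := by
    rw [← det_fromBlocks_zero₂₁ Y C Z, ← hg]; exact g.2
  have hZ : Z⁻¹ * Z = 1 :=
    nonsing_inv_mul _ (isUnit_iff_ne_zero.2 (right_ne_zero_of_mul_eq_one hdet))
  have hα : (Fintype.card α : ℝ) ≠ 0 := by simp
  have hβ : (Fintype.card β : ℝ) ≠ 0 := by simp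
  let t : ℝ := Real.log Y.det / (Fintype.card α * Fintype.card β)
  have ht : Real.exp (Fintype.card α * (Fintype.card β * t)) = Y.det := by
    rw [← mul_assoc, mul_div_cancel₀ _ (mul_ne_zero hα hβ), Real.exp_log hY]
  have hY' : (Real.exp (-(Fintype.card β * t)) • Y).det = 1 := by
    rw [det_smul, ← Real.exp_nat_mul, mul_neg, Real.exp_neg, ht, inv_mul_cancel₀ hY.ne']
  have hZ' : (Real.exp (Fintype.card α * t) • Z).det = 1 := by
    rw [det_smul, ← Real.exp_nat_mul, mul_left_comm, ht, hdet]
  refine ⟨(C * Z⁻¹, t), ⟨fromBlocks (Real.exp (-(Fintype.card β * t)) • Y) 0 0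
    (Real.exp (Fintype.card α * t) • Z), by rw [det_fromBlocks_zero₂₁, hY', hZ', one_mul]⟩,
    ⟨toBlocks_fromBlocks₁₂ _ _ _ _, toBlocks_fromBlocks₂₁ _ _ _ _, ?_⟩, ?_⟩
  · exact (congrArg Matrix.det (toBlocks_fromBlocks₁₁ _ _ _ _)).trans hY'
  · refine Subtype.ext (hg.trans ?_)
    change _ = fromBlocks (Real.exp (Fintype.card β * t) • 1)
      (Real.exp (-(Fintype.card α * t)) • (C * Z⁻¹)) 0 (Real.exp (-(Fintype.card α * t)) • 1) *
      fromBlocks (Real.exp (-(Fintype.card β * t)) • Y) 0 0 (Real.exp (Fintype.card α * t) • Z)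
    rw [fromBlocks_multiply]
    simp [smul_smul, ← Real.exp_add, Matrix.mul_assoc, hZ]

/-- A variant of the Iwasawa decomposition, adapted to a block decomposition. -/
lemma exists_specialOrthogonal_mul_unipotentMulScalar_mul [Nonempty α] [Nonempty β]
    (g : SpecialLinearGroup (α ⊕ β) ℝ) :
    ∃ κ ∈ specialOrthogonalSet (α ⊕ β), ∃ e, ∃ h ∈ blockDiagonalSet α β,
      g = κ * unipotentMulScalar e * h := by
  obtain ⟨A, B, C, D, hS⟩ : ∃ A B C D, (g : Matrix (α ⊕ β) (α ⊕ β) ℝ)ᵀ *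
      (g : Matrix (α ⊕ β) (α ⊕ β) ℝ) = fromBlocks A B C D :=
    ⟨_, _, _, _, (fromBlocks_toBlocks _).symm⟩
  have hpos := posDef_transpose_mul_self g
  have hSdet := congrArg Matrix.det hS
  rw [det_mul, det_transpose, g.2, mul_one] at hSdet
  rw [hS] at hpos
  have hA : A.PosDef := hpos.submatrix (e := Sum.inl) Sum.inl_injective
  obtain ⟨hAH, hC, -, -⟩ := isHermitian_fromBlocks_iff.1 hpos.1
  rw [conjTranspose_eq_transpose_of_trivial] at hC
  subst hC
  have hA0 : IsUnit A.det := isUnit_iff_ne_zero.2 hA.det_pos.ne'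
  let _ := A.invertibleOfIsUnitDet hA0
  have hAA : A * A⁻¹ = 1 := mul_nonsing_inv _ hA0
  have hAt : A⁻¹ᵀ * A = 1 := by
    rw [← transpose_one, ← hAA, transpose_mul, ← conjTranspose_eq_transpose_of_trivial A, hAH.eq]
  rw [det_fromBlocks₁₁, invOf_eq_nonsing_inv] at hSdet
  have hschur := (hA.fromBlocks₁₁ B D).1
    (by rw [conjTranspose_eq_transpose_of_trivial]; exact hpos.posSemidef)
  rw [conjTranspose_eq_transpose_of_trivial] at hschur
  obtain ⟨Y, hY, hY0⟩ := exists_transpose_mul_self_eq hA.posSemidef hA.det_pos.ne'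
  obtain ⟨Z, hZ, hZ0⟩ := exists_transpose_mul_self_eq hschur
    (right_ne_zero_of_mul_eq_one hSdet.symm)
  obtain ⟨hdet, κ, hκ, hg⟩ := exists_mem_specialOrthogonalSet_mul (g := g)
    (R := fromBlocks Y (Y * A⁻¹ * B) 0 Z)
    (by rw [det_fromBlocks_zero₂₁]; exact mul_pos hY0 hZ0) (by
      rw [hS, fromBlocks_transpose, fromBlocks_multiply]
      have h1 : Yᵀ * (Y * A⁻¹ * B) = B := by
        rw [Matrix.mul_assoc Y, ← Matrix.mul_assoc, hY, ← Matrix.mul_assoc, hAA, Matrix.one_mul]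
      have h2 : (Y * A⁻¹ * B)ᵀ * Y = Bᵀ := by
        rw [transpose_mul, transpose_mul, Matrix.mul_assoc, Matrix.mul_assoc, hY, hAt,
          Matrix.mul_one]
      have h3 : (Y * A⁻¹ * B)ᵀ * (Y * A⁻¹ * B) = Bᵀ * A⁻¹ * B := by
        rw [Matrix.mul_assoc Y, ← Matrix.mul_assoc, ← Matrix.mul_assoc Y, h2, Matrix.mul_assoc]
      rw [h1, h2, h3, hY, hZ]
      simp)
  obtain ⟨e, h, hh, he⟩ := exists_fromBlocks_zero_eq (g := ⟨_, hdet⟩) rfl hY0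
  refine ⟨κ, hκ, e, h, hh, ?_⟩
  rw [mul_assoc, ← he]
  exact Subtype.ext hg

/-- A continuous left inverse of `unipotentMulScalar`, invariant under the right action of the
block-diagonal subgroup. -/
def blockCoordinates (g : SpecialLinearGroup (α ⊕ β) ℝ) : (α → β → ℝ) × ℝ :=
  (fun i j => -((g : Matrix (α ⊕ β) (α ⊕ β) ℝ) * fromBlocks 1 0 0 0 *
      ((g⁻¹ : SpecialLinearGroup (α ⊕ β) ℝ) : Matrix (α ⊕ β) (α ⊕ β) ℝ) : Matrix (α ⊕ β) (α ⊕ β) ℝ)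
        (Sum.inl i) (Sum.inr j),
    Real.log ((g : Matrix (α ⊕ β) (α ⊕ β) ℝ)ᵀ * (g : Matrix (α ⊕ β) (α ⊕ β) ℝ)).toBlocks₁₁.det /
      (2 * Fintype.card α * Fintype.card β))

lemma det_toBlocks₁₁_transpose_mul_self_pos (g : SpecialLinearGroup (α ⊕ β) ℝ) :
    0 < ((g : Matrix (α ⊕ β) (α ⊕ β) ℝ)ᵀ * (g : Matrix (α ⊕ β) (α ⊕ β) ℝ)).toBlocks₁₁.det :=
  ((posDef_transpose_mul_self g).submatrix (e := Sum.inl) Sum.inl_injective).det_pos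

lemma continuous_blockCoordinates :
    Continuous (blockCoordinates : SpecialLinearGroup (α ⊕ β) ℝ → (α → β → ℝ) × ℝ) := by
  have h1 : Continuous fun g : SpecialLinearGroup (α ⊕ β) ℝ => (g : Matrix (α ⊕ β) (α ⊕ β) ℝ) :=
    continuous_subtype_val
  have h2 : Continuous fun g : SpecialLinearGroup (α ⊕ β) ℝ =>
      ((g⁻¹ : SpecialLinearGroup (α ⊕ β) ℝ) : Matrix (α ⊕ β) (α ⊕ β) ℝ) :=
    h1.comp continuous_inv
  refine .prodMk (continuous_pi fun i => continuous_pi fun j => ?_) (.div_const (.log ?_ fun g =>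
    (det_toBlocks₁₁_transpose_mul_self_pos g).ne') _)
  · exact ((h1.matrix_mul continuous_const).matrix_mul h2).matrix_elem _ _ |>.neg
  · exact ((h1.matrix_transpose.matrix_mul h1).matrix_submatrix Sum.inl Sum.inl).matrix_det

lemma blockCoordinates_mul (g : SpecialLinearGroup (α ⊕ β) ℝ) {h : SpecialLinearGroup (α ⊕ β) ℝ}
    (hh : h ∈ blockDiagonalSet α β) : blockCoordinates (g * h) = blockCoordinates g := by
  obtain ⟨X, W, hX, hXW⟩ : ∃ X W, X.det = 1 ∧
      (h : Matrix (α ⊕ β) (α ⊕ β) ℝ) = fromBlocks X 0 0 W :=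
    ⟨_, (h : Matrix (α ⊕ β) (α ⊕ β) ℝ).toBlocks₂₂, hh.2.2, by
      conv_lhs => rw [← fromBlocks_toBlocks (h : Matrix (α ⊕ β) (α ⊕ β) ℝ), hh.1, hh.2.1]⟩
  refine Prod.ext (funext fun i => funext fun j => ?_) ?_
  · have hcoe : (((g * h)⁻¹ : SpecialLinearGroup (α ⊕ β) ℝ) : Matrix (α ⊕ β) (α ⊕ β) ℝ) =
        ((h⁻¹ : SpecialLinearGroup (α ⊕ β) ℝ) : Matrix (α ⊕ β) (α ⊕ β) ℝ) *
        ((g⁻¹ : SpecialLinearGroup (α ⊕ β) ℝ) : Matrix (α ⊕ β) (α ⊕ β) ℝ) :=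
      congrArg Subtype.val (mul_inv_rev g h)
    have hcomm : (h : Matrix (α ⊕ β) (α ⊕ β) ℝ) * fromBlocks 1 0 0 0 =
        fromBlocks 1 0 0 0 * (h : Matrix (α ⊕ β) (α ⊕ β) ℝ) := by
      rw [hXW, fromBlocks_multiply, fromBlocks_multiply]; simp
    change -((g : Matrix (α ⊕ β) (α ⊕ β) ℝ) * (h : Matrix (α ⊕ β) (α ⊕ β) ℝ) * fromBlocks 1 0 0 0 *
      (((g * h)⁻¹ : SpecialLinearGroup (α ⊕ β) ℝ) : Matrix (α ⊕ β) (α ⊕ β) ℝ) : Matrix (α ⊕ β) (α ⊕ β) ℝ)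
        (Sum.inl i) (Sum.inr j) =
      -((g : Matrix (α ⊕ β) (α ⊕ β) ℝ) * fromBlocks 1 0 0 0 *
      ((g⁻¹ : SpecialLinearGroup (α ⊕ β) ℝ) : Matrix (α ⊕ β) (α ⊕ β) ℝ) : Matrix (α ⊕ β) (α ⊕ β) ℝ)
        (Sum.inl i) (Sum.inr j)
    rw [hcoe, Matrix.mul_assoc (g : Matrix (α ⊕ β) (α ⊕ β) ℝ), hcomm, ← Matrix.mul_assoc,
      ← Matrix.mul_assoc, Matrix.mul_assoc _ (h : Matrix (α ⊕ β) (α ⊕ β) ℝ), coe_mul_coe_inv,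
      Matrix.mul_one]
  · change Real.log (((g : Matrix (α ⊕ β) (α ⊕ β) ℝ) * (h : Matrix (α ⊕ β) (α ⊕ β) ℝ))ᵀ *
      ((g : Matrix (α ⊕ β) (α ⊕ β) ℝ) * (h : Matrix (α ⊕ β) (α ⊕ β) ℝ))).toBlocks₁₁.det / _ =
      Real.log ((g : Matrix (α ⊕ β) (α ⊕ β) ℝ)ᵀ * (g : Matrix (α ⊕ β) (α ⊕ β) ℝ)).toBlocks₁₁.det / _
    rw [transpose_mul, Matrix.mul_assoc, ← Matrix.mul_assoc (g : Matrix (α ⊕ β) (α ⊕ β) ℝ)ᵀ]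
    conv_lhs => rw [← fromBlocks_toBlocks ((g : Matrix (α ⊕ β) (α ⊕ β) ℝ)ᵀ *
      (g : Matrix (α ⊕ β) (α ⊕ β) ℝ))]
    rw [hXW, fromBlocks_transpose, fromBlocks_multiply, fromBlocks_multiply]
    simp [hX]

lemma blockCoordinates_unipotentMulScalar [Nonempty α] [Nonempty β] (e : (α → β → ℝ) × ℝ) :
    blockCoordinates (unipotentMulScalar e) = e := by
  obtain ⟨B, t⟩ := e
  have hα : (Fintype.card α : ℝ) ≠ 0 := by simp
  have hβ : (Fintype.card β : ℝ) ≠ 0 := by simp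
  refine Prod.ext (funext fun i => funext fun j => ?_) ?_
  · let r : Matrix (α ⊕ β) (α ⊕ β) ℝ := fromBlocks (Real.exp (-(Fintype.card β * t)) • 1)
      (-Real.exp (-(Fintype.card β * t)) • of B) 0 (Real.exp (Fintype.card α * t) • 1)
    have hr : r = (((unipotentMulScalar (B, t))⁻¹ : SpecialLinearGroup (α ⊕ β) ℝ) :
        Matrix (α ⊕ β) (α ⊕ β) ℝ) := by
      refine left_inv_eq_right_inv ?_ (coe_mul_coe_inv (unipotentMulScalar (B, t)))
      change fromBlocks _ _ _ _ * fromBlocks _ _ _ _ = 1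
      rw [fromBlocks_multiply, ← fromBlocks_one]
      simp [smul_smul, ← Real.exp_add, add_comm]
    change -(fromBlocks (Real.exp (Fintype.card β * t) • 1)
      (Real.exp (-(Fintype.card α * t)) • of B) 0 (Real.exp (-(Fintype.card α * t)) • 1) *
      fromBlocks 1 0 0 0 * (((unipotentMulScalar (B, t))⁻¹ : SpecialLinearGroup (α ⊕ β) ℝ) :
        Matrix (α ⊕ β) (α ⊕ β) ℝ) : Matrix (α ⊕ β) (α ⊕ β) ℝ) (Sum.inl i) (Sum.inr j) = B i j
    rw [← hr, fromBlocks_multiply, fromBlocks_multiply, fromBlocks_apply₁₂]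
    simp [smul_smul, ← Real.exp_add]
  · change Real.log (toBlocks₁₁ ((fromBlocks _ _ _ _)ᵀ * fromBlocks _ _ _ _)).det / _ = t
    rw [fromBlocks_transpose, fromBlocks_multiply, toBlocks_fromBlocks₁₁]
    simp [smul_smul, ← Real.exp_add, ← Real.exp_nat_mul]
    field_simp
    ring

end Blocks

section ExteriorNorm

open Set Topology

variable {ι : Type*} [Fintype ι] [DecidableEq ι] {p : ℕ}

/-- The operator norm of the pullback of alternating `p`-forms along a matrix. -/
def exteriorNorm (p : ℕ) (M : Matrix ι ι ℝ) : ℝ :=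
  ‖(ContinuousAlternatingMap.compContinuousLinearMapCLM (toLin' M).toContinuousLinearMap :
    ((ι → ℝ) [⋀^Fin p]→L[ℝ] ℝ) →L[ℝ] (ι → ℝ) [⋀^Fin p]→L[ℝ] ℝ)‖

lemma continuous_exteriorNorm : Continuous (exteriorNorm p : Matrix ι ι ℝ → ℝ) := by
  have h : Continuous fun M : Matrix ι ι ℝ => (toLin' M).toContinuousLinearMap :=
    ((LinearMap.toContinuousLinearMap (𝕜 := ℝ) (E := ι → ℝ) (F' := ι → ℝ)).toLinearMap ∘ₗ
      (toLin' (R := ℝ) (m := ι) (n := ι)).toLinearMap).continuous_of_finiteDimensional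
  have h' : Continuous fun M : Matrix ι ι ℝ =>
      (ContinuousAlternatingMap.compContinuousLinearMapCLM (toLin' M).toContinuousLinearMap :
        ((ι → ℝ) [⋀^Fin p]→L[ℝ] ℝ) →L[ℝ] (ι → ℝ) [⋀^Fin p]→L[ℝ] ℝ) :=
    ContinuousAlternatingMap.continuous_compContinuousLinearMapCLM.comp h
  exact (continuous_norm
    (E := ((ι → ℝ) [⋀^Fin p]→L[ℝ] ℝ) →L[ℝ] (ι → ℝ) [⋀^Fin p]→L[ℝ] ℝ)).comp h'

lemma exteriorNorm_mul_le (M N : Matrix ι ι ℝ) :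
    exteriorNorm p (M * N) ≤ exteriorNorm p M * exteriorNorm p N := by
  rw [mul_comm]
  refine le_trans (le_of_eq ?_) (ContinuousLinearMap.opNorm_comp_le _ _)
  unfold exteriorNorm
  congr 1
  ext ω v
  simp only [ContinuousAlternatingMap.compContinuousLinearMapCLM_apply,
    ContinuousAlternatingMap.compContinuousLinearMap_apply, ContinuousLinearMap.comp_apply]
  congr 1
  ext i
  simp [mulVec_mulVec]

lemma exteriorNorm_diagonal_le {c : ℝ} {d : ι → ℝ}
    (hd : ∀ r : Fin p → ι, Function.Injective r → |∏ i, d (r i)| ≤ c) (hc : 0 ≤ c) :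
    exteriorNorm p (diagonal d) ≤ (Fintype.card ι : ℝ) ^ p * c := by
  refine ContinuousLinearMap.opNorm_le_bound _ (by positivity) fun ω => ?_
  refine ContinuousAlternatingMap.opNorm_le_bound _ (by positivity) fun v => ?_
  have hexp (i : Fin p) : diagonal d *ᵥ v i = ∑ j, (d j * v i j) • Pi.single j (1 : ℝ) := by
    ext j
    simp [mulVec_diagonal, Finset.sum_apply, Pi.single_apply]
  have hsum : ω (fun i => diagonal d *ᵥ v i) =
      ∑ r : Fin p → ι, (∏ i, d (r i) * v i (r i)) * ω fun i => Pi.single (r i) 1 := by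
    simp_rw [hexp, ContinuousAlternatingMap.map_sum, ContinuousAlternatingMap.map_smul_univ,
      smul_eq_mul]
  have hterm (r : Fin p → ι) : ‖(∏ i, d (r i) * v i (r i)) * ω fun i => Pi.single (r i) 1‖ ≤
      c * ‖ω‖ * ∏ i, ‖v i‖ := by
    by_cases hr : Function.Injective r
    · have h1 : ‖ω fun i => Pi.single (r i) 1‖ ≤ ‖ω‖ := by
        simpa [Pi.norm_single] using ω.le_opNorm fun i => Pi.single (r i) 1
      have h2 : ∏ i, |v i (r i)| ≤ ∏ i, ‖v i‖ :=
        Finset.prod_le_prod (fun i _ => abs_nonneg _) fun i _ => norm_le_pi_norm (v i) (r i)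
      rw [norm_mul, Finset.prod_mul_distrib, norm_mul, Real.norm_eq_abs, Real.norm_eq_abs,
        Finset.abs_prod (f := fun i => v i (r i))]
      calc |∏ i, d (r i)| * (∏ i, |v i (r i)|) * ‖ω fun i => Pi.single (r i) 1‖
          ≤ c * (∏ i, ‖v i‖) * ‖ω‖ := by
            gcongr
            exact hd r hr
        _ = _ := by ring
    · obtain ⟨i, j, hij, hne⟩ : ∃ i j, r i = r j ∧ i ≠ j := by
        simpa [Function.Injective] using hr
      rw [ω.map_eq_zero_of_eq _ (by rw [hij]) hne]
      simp only [mul_zero, norm_zero]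
      positivity
  calc ‖ω (fun i => diagonal d *ᵥ v i)‖
      ≤ ∑ _r : Fin p → ι, c * ‖ω‖ * ∏ i, ‖v i‖ := hsum ▸ norm_sum_le_of_le _ fun r _ => hterm r
    _ = _ := by simp; ring

lemma abs_prod_le_exteriorNorm_diagonal (r : Fin p ↪ ι) (d : ι → ℝ) :
    |∏ i, d (r i)| ≤ exteriorNorm p (diagonal d) := by
  let ω : (ι → ℝ) [⋀^Fin p]→L[ℝ] ℝ :=
    { (detRowAlternating (n := Fin p) (R := ℝ)).compLinearMap (LinearMap.funLeft ℝ ℝ r) with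
      cont := by
        change Continuous fun v : Fin p → ι → ℝ => det (of fun i j => v i (r j))
        refine Continuous.matrix_det ?_
        exact continuous_pi fun i => continuous_pi fun j =>
          (continuous_apply (r j)).comp (continuous_apply i) }
  have hω (v : Fin p → ι → ℝ) : ω v = det (of fun i j => v i (r j)) := rfl
  have hpos : 0 < ‖ω‖ := by
    refine norm_pos_iff.2 fun h => ?_
    have h1 : ω (fun i => Pi.single (r i) 1) = 1 := by
      rw [hω, ← det_one (n := Fin p)]
      congr 1
      ext i j
      simp [Pi.single_apply, Matrix.one_apply, eq_comm]
    simp [h] at h1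
  have heq : ContinuousAlternatingMap.compContinuousLinearMapCLM
      (toLin' (diagonal d)).toContinuousLinearMap ω = (∏ i, d (r i)) • ω := by
    ext v
    change ω (fun i => diagonal d *ᵥ v i) = (∏ i, d (r i)) * ω v
    rw [hω, hω, ← det_mul_row]
    simp [mulVec_diagonal]
  have := ContinuousLinearMap.le_opNorm (ContinuousAlternatingMap.compContinuousLinearMapCLM
      (toLin' (diagonal d)).toContinuousLinearMap) ω
  rw [heq, norm_smul] at this
  exact le_of_mul_le_mul_right this hpos

lemma exteriorNorm_pos (hp : p ≤ Fintype.card ι) (g : SpecialLinearGroup ι ℝ) :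
    0 < exteriorNorm p (g : Matrix ι ι ℝ) := by
  obtain ⟨r⟩ : Nonempty (Fin p ↪ ι) := Function.Embedding.nonempty_of_card_le (by simpa)
  have h1 : 1 ≤ exteriorNorm p (1 : Matrix ι ι ℝ) := by
    simpa using abs_prod_le_exteriorNorm_diagonal r 1
  rw [← coe_mul_coe_inv g] at h1
  have h0 : 0 ≤ exteriorNorm p (g : Matrix ι ι ℝ) := by
    unfold exteriorNorm; positivity
  refine h0.lt_of_ne' fun h => ?_
  have := exteriorNorm_mul_le (p := p) (g : Matrix ι ι ℝ) (g⁻¹ : SpecialLinearGroup ι ℝ)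
  rw [h] at this
  linarith

end ExteriorNorm

section Gauge

open Set Topology

variable {ι : Type*} [Fintype ι] {p : ℕ}

lemma exists_card_eq_of_threshold (hp : 0 < p) (hpι : 2 * p ≤ Fintype.card ι) (x : ι → ℝ) :
    ∃ I J : Finset ι, Disjoint I J ∧ I.card = p ∧ J.card = p ∧
      (∃ c, (∀ i ∈ I, c ≤ x i) ∧ ∀ i ∉ I, x i ≤ c) ∧
      ∃ c, (∀ i ∈ J, x i ≤ c) ∧ ∀ i ∉ J, c ≤ x i := by
  obtain ⟨n, hn⟩ : ∃ n, Fintype.card ι = n := ⟨_, rfl⟩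
  obtain ⟨e, he⟩ : ∃ e : Fin n ≃ ι, Monotone (x ∘ e) :=
    ⟨(Tuple.sort (x ∘ (Fintype.equivFinOfCardEq hn).symm)).trans
      (Fintype.equivFinOfCardEq hn).symm, Tuple.monotone_sort (x ∘ _)⟩
  rw [hn] at hpι
  let j : Fin p ↪ ι := (Fin.castLEEmb (by omega : p ≤ n)).trans e.toEmbedding
  let i : Fin p ↪ ι := (Fin.castLEEmb (by omega : p ≤ n)).trans
    (Fin.revPerm.toEmbedding.trans e.toEmbedding)
  have hj (a : Fin n) : e a ∈ Finset.univ.map j ↔ a.val < p := by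
    simp only [Finset.mem_map, Finset.mem_univ, true_and]
    exact ⟨fun ⟨b, hb⟩ => by simp [← e.injective hb], fun h => ⟨⟨a, h⟩, rfl⟩⟩
  have hi (a : Fin n) : e a ∈ Finset.univ.map i ↔ n - p ≤ a.val := by
    simp only [Finset.mem_map, Finset.mem_univ, true_and]
    refine ⟨fun ⟨b, hb⟩ => ?_, fun h => ⟨⟨n - 1 - a, by omega⟩, ?_⟩⟩
    · rw [← e.injective hb]
      simp [Fin.val_rev]
      omega
    · refine congrArg e (Fin.ext ?_)
      simp [Fin.val_rev]
      omega
  refine ⟨Finset.univ.map i, Finset.univ.map j, ?_, by simp, by simp,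
    ⟨x (e ⟨n - p, by omega⟩), ?_, ?_⟩, ⟨x (e ⟨p - 1, by omega⟩), ?_, ?_⟩⟩
  · refine Finset.disjoint_left.2 fun a => ?_
    obtain ⟨a, rfl⟩ := e.surjective a
    rw [hi, hj]
    omega
  all_goals
    intro a
    obtain ⟨a, rfl⟩ := e.surjective a
    first | rw [hi] | rw [hj]
    intro h
    refine he (Fin.le_def.2 ?_)
    simp only
    omega

variable [DecidableEq ι]

lemma sum_le_sum_of_card_eq_of_threshold {I K : Finset ι} {x : ι → ℝ} {c : ℝ}
    (hI : ∀ i ∈ I, c ≤ x i) (hI' : ∀ i ∉ I, x i ≤ c) (hK : K.card = I.card) :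
    ∑ i ∈ K, x i ≤ ∑ i ∈ I, x i := by
  have h : ∑ i ∈ K, (x i - c) ≤ ∑ i ∈ I, (x i - c) := by
    rw [← Fintype.sum_ite_mem K, ← Fintype.sum_ite_mem I]
    refine Finset.sum_le_sum fun i _ => ?_
    have h1 := hI i
    have h2 := hI' i
    split_ifs <;> grind
  simpa [Finset.sum_sub_distrib, hK] using h

/-- An odd function on the special linear group comparing the growth of a matrix with that of its
inverse on `p`-forms. -/
def exteriorGauge (p : ℕ) (g : SpecialLinearGroup ι ℝ) : ℝ :=
  Real.log (exteriorNorm p (g : Matrix ι ι ℝ)) -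
    Real.log (exteriorNorm p ((g⁻¹ : SpecialLinearGroup ι ℝ) : Matrix ι ι ℝ))

lemma exteriorGauge_inv (g : SpecialLinearGroup ι ℝ) :
    exteriorGauge p g⁻¹ = -exteriorGauge p g := by
  simp only [exteriorGauge, inv_inv, neg_sub]

lemma log_exteriorNorm_mul_le (hp : p ≤ Fintype.card ι) (g h : SpecialLinearGroup ι ℝ) :
    Real.log (exteriorNorm p ((g * h : SpecialLinearGroup ι ℝ) : Matrix ι ι ℝ)) ≤
      Real.log (exteriorNorm p (g : Matrix ι ι ℝ)) +
        Real.log (exteriorNorm p (h : Matrix ι ι ℝ)) := by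
  rw [← Real.log_mul (exteriorNorm_pos hp g).ne' (exteriorNorm_pos hp h).ne']
  exact Real.log_le_log (exteriorNorm_pos hp _) (exteriorNorm_mul_le _ _)

lemma abs_exteriorGauge_mul_sub_le (hp : p ≤ Fintype.card ι) (g h : SpecialLinearGroup ι ℝ) :
    |exteriorGauge p (g * h) - exteriorGauge p g| ≤
      2 * (|Real.log (exteriorNorm p (h : Matrix ι ι ℝ))| +
        |Real.log (exteriorNorm p ((h⁻¹ : SpecialLinearGroup ι ℝ) : Matrix ι ι ℝ))|) := by
  have h1 := log_exteriorNorm_mul_le hp g h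
  have h2 := log_exteriorNorm_mul_le hp (g * h) h⁻¹
  have h3 := log_exteriorNorm_mul_le hp h⁻¹ g⁻¹
  have h4 := log_exteriorNorm_mul_le hp h (h⁻¹ * g⁻¹)
  rw [mul_inv_cancel_right] at h2
  rw [mul_inv_cancel_left] at h4
  have h5 := abs_le.1 (le_refl |Real.log (exteriorNorm p (h : Matrix ι ι ℝ))|)
  have h6 := abs_le.1 (le_refl |Real.log
    (exteriorNorm p ((h⁻¹ : SpecialLinearGroup ι ℝ) : Matrix ι ι ℝ))|)
  rw [exteriorGauge, exteriorGauge, _root_.mul_inv_rev, abs_le]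
  constructor <;> linarith

lemma log_exteriorNorm_diagonal_exp_mem {I : Finset ι} (hI : I.card = p) {x : ι → ℝ} {c : ℝ}
    (hIc : ∀ i ∈ I, c ≤ x i) (hIc' : ∀ i ∉ I, x i ≤ c) :
    Real.log (exteriorNorm p (diagonal fun i => Real.exp (x i))) ∈
      Icc (∑ i ∈ I, x i) (∑ i ∈ I, x i + p * Real.log (Fintype.card ι)) := by
  have hlow : Real.exp (∑ i ∈ I, x i) ≤ exteriorNorm p (diagonal fun i => Real.exp (x i)) := by
    have := abs_prod_le_exteriorNorm_diagonal ((I.equivFinOfCardEq hI).symm.toEmbedding.trans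
      (Function.Embedding.subtype _)) fun i => Real.exp (x i)
    rw [← Real.exp_sum, Real.abs_exp] at this
    refine le_of_eq_of_le (congrArg _ ?_) this
    rw [← Finset.sum_coe_sort]
    exact ((I.equivFinOfCardEq hI).symm.sum_comp fun i : I => x i).symm
  have hup := exteriorNorm_diagonal_le (p := p) (d := fun i => Real.exp (x i))
    (c := Real.exp (∑ i ∈ I, x i)) (fun r hr => by
      rw [← Real.exp_sum, Real.abs_exp, Real.exp_le_exp]
      simpa using sum_le_sum_of_card_eq_of_threshold hIc hIc'
        (K := Finset.univ.map ⟨r, hr⟩) (by simp [hI])) (Real.exp_pos _).le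
  have hpos := (Real.exp_pos _).trans_le hlow
  refine ⟨(Real.le_log_iff_exp_le hpos).2 hlow, (Real.log_le_log hpos hup).trans_eq ?_⟩
  have hne : (Fintype.card ι : ℝ) ^ p ≠ 0 := fun h => by
    rw [h, zero_mul] at hup
    linarith
  rw [Real.log_mul hne (Real.exp_pos _).ne', Real.log_exp, Real.log_pow, add_comm]

lemma coe_inv_eq_diagonal_exp_neg {a : SpecialLinearGroup ι ℝ} {x : ι → ℝ}
    (ha : (a : Matrix ι ι ℝ) = diagonal fun i => Real.exp (x i)) :
    ((a⁻¹ : SpecialLinearGroup ι ℝ) : Matrix ι ι ℝ) = diagonal fun i => Real.exp (-x i) := by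
  have h : (diagonal fun i => Real.exp (-x i)) * (a : Matrix ι ι ℝ) = 1 := by
    rw [ha, diagonal_mul_diagonal]
    simp [← Real.exp_add]
  calc _ = ((diagonal fun i => Real.exp (-x i)) * (a : Matrix ι ι ℝ)) *
        ((a⁻¹ : SpecialLinearGroup ι ℝ) : Matrix ι ι ℝ) := by rw [h, Matrix.one_mul]
    _ = _ := by rw [Matrix.mul_assoc, coe_mul_coe_inv, Matrix.mul_one]

lemma exists_abs_exteriorGauge_sub_sum_le (hp : 0 < p) (hpι : 2 * p ≤ Fintype.card ι)
    {a : SpecialLinearGroup ι ℝ} {x : ι → ℝ}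
    (ha : (a : Matrix ι ι ℝ) = diagonal fun i => Real.exp (x i)) :
    ∃ S : Finset ι, S.card = 2 * p ∧
      |exteriorGauge p a - ∑ i ∈ S, x i| ≤ p * Real.log (Fintype.card ι) := by
  obtain ⟨I, J, hIJ, hI, hJ, ⟨c, hc, hc'⟩, d, hd, hd'⟩ := exists_card_eq_of_threshold hp hpι x
  refine ⟨I ∪ J, by rw [Finset.card_union_of_disjoint hIJ]; omega, ?_⟩
  have h1 := log_exteriorNorm_diagonal_exp_mem hI hc hc'
  have h2 := log_exteriorNorm_diagonal_exp_mem (x := fun i => -x i) (c := -d) hJ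
    (fun i hi => neg_le_neg (hd i hi)) (fun i hi => neg_le_neg (hd' i hi))
  rw [← ha] at h1
  rw [← coe_inv_eq_diagonal_exp_neg ha, Finset.sum_neg_distrib] at h2
  rw [Finset.sum_union hIJ, exteriorGauge, abs_le]
  constructor <;> linarith [h1.1, h1.2, h2.1, h2.2]

lemma exists_forall_abs_log_exteriorNorm_le (hp : p ≤ Fintype.card ι) :
    ∃ B, ∀ k ∈ specialOrthogonalSet ι, |Real.log (exteriorNorm p (k : Matrix ι ι ℝ))| ≤ B := by
  have h : Continuous fun k : SpecialLinearGroup ι ℝ =>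
      Real.log (exteriorNorm p (k : Matrix ι ι ℝ)) :=
    (continuous_exteriorNorm.comp continuous_subtype_val).log fun k => (exteriorNorm_pos hp k).ne'
  exact isCompact_specialOrthogonalSet.exists_bound_of_continuousOn h.continuousOn

end Gauge

section Properness

open Set Topology

variable {α β : Type*} [Fintype α] [DecidableEq α] [Fintype β] [DecidableEq β] {p : ℕ}

lemma eq_of_coe_mul_mul_coe_eq {ι : Type*} [Fintype ι] [DecidableEq ι]
    {k l : SpecialLinearGroup ι ℝ} {X Y : Matrix ι ι ℝ}
    (h : (k : Matrix ι ι ℝ) * X * (l : Matrix ι ι ℝ) =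
      (k : Matrix ι ι ℝ) * Y * (l : Matrix ι ι ℝ)) :
    X = Y := by
  have hk : IsUnit (k : Matrix ι ι ℝ) := (isUnit_iff_isUnit_det _).2 (by simp)
  have hl : IsUnit (l : Matrix ι ι ℝ) := (isUnit_iff_isUnit_det _).2 (by simp)
  exact hk.mul_left_cancel (hl.mul_right_cancel h)

lemma eq_unipotentMulScalar_mul_of_eq_diagonal [Nonempty α] [Nonempty β]
    {d : SpecialLinearGroup (α ⊕ β) ℝ} {y : α ⊕ β → ℝ}
    (hd : (d : Matrix (α ⊕ β) (α ⊕ β) ℝ) = diagonal fun i => Real.exp (y i)) :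
    ∃ h ∈ blockDiagonalSet α β,
      d = unipotentMulScalar (0, (∑ i, y (Sum.inl i)) / (Fintype.card α * Fintype.card β)) * h := by
  set t := (∑ i, y (Sum.inl i)) / (Fintype.card α * Fintype.card β : ℝ) with ht
  have hα : (Fintype.card α : ℝ) ≠ 0 := Nat.cast_ne_zero.2 Fintype.card_ne_zero
  have hβ : (Fintype.card β : ℝ) ≠ 0 := Nat.cast_ne_zero.2 Fintype.card_ne_zero
  have hz : (unipotentMulScalar ((0 : α → β → ℝ), t) : Matrix (α ⊕ β) (α ⊕ β) ℝ) *
      fromBlocks (diagonal fun i => Real.exp (y (Sum.inl i) - Fintype.card β * t)) 0 0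
        (diagonal fun i => Real.exp (y (Sum.inr i) + Fintype.card α * t)) =
      (d : Matrix (α ⊕ β) (α ⊕ β) ℝ) := by
    rw [hd]
    change fromBlocks (Real.exp (Fintype.card β * t) • 1) (Real.exp (-(Fintype.card α * t)) • 0) 0
      (Real.exp (-(Fintype.card α * t)) • 1) * _ = _
    rw [fromBlocks_multiply]
    simp only [smul_zero, Matrix.mul_zero, Matrix.zero_mul, add_zero, zero_add, smul_mul_assoc,
      Matrix.one_mul, ← diagonal_smul]
    rw [fromBlocks_diagonal]
    congr 1
    ext (i | i) <;> simp [← Real.exp_add]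
  have hdet := congrArg det hz
  rw [det_mul, (unipotentMulScalar (0, t)).2, d.2, one_mul] at hdet
  refine ⟨⟨_, hdet⟩, ⟨toBlocks_fromBlocks₁₂ .., toBlocks_fromBlocks₂₁ .., ?_⟩,
    Subtype.ext hz.symm⟩
  change (toBlocks₁₁ (fromBlocks _ _ _ _)).det = 1
  rw [toBlocks_fromBlocks₁₁, det_diagonal, ← Real.exp_sum, Real.exp_eq_one_iff,
    Finset.sum_sub_distrib, Finset.sum_const, Finset.card_univ, nsmul_eq_mul, ht]
  field_simp
  ring

lemma exists_perm_sum_eq {ι : Type*} [Fintype ι] [DecidableEq ι] {S T : Finset ι}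
    (h : S.card = T.card) (x : ι → ℝ) :
    ∃ σ : Equiv.Perm ι, ∑ i ∈ T, x (σ i) = ∑ i ∈ S, x i := by
  obtain ⟨e⟩ : Nonempty (T ≃ S) := ⟨Finset.equivOfCardEq h.symm⟩
  refine ⟨e.extendSubtype, ?_⟩
  rw [← Finset.sum_coe_sort, ← Finset.sum_coe_sort S, ← e.sum_comp]
  exact Finset.sum_congr rfl fun i _ => by rw [e.extendSubtype_apply_of_mem i i.2]

lemma exists_perm_abs_sum_inl_eq {S : Finset (α ⊕ β)}
    (hS : S.card = Fintype.card α ∨ S.card = Fintype.card β) {x : α ⊕ β → ℝ}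
    (hx : ∑ i, x i = 0) :
    ∃ σ : Equiv.Perm (α ⊕ β), |∑ i, x (σ (Sum.inl i))| = |∑ i ∈ S, x i| := by
  obtain hS | hS := hS
  · obtain ⟨σ, hσ⟩ := exists_perm_sum_eq (T := Finset.univ.map Function.Embedding.inl)
      (by simpa using hS) x
    exact ⟨σ, by rw [← hσ, Finset.sum_map]; rfl⟩
  · obtain ⟨σ, hσ⟩ := exists_perm_sum_eq (T := Finset.univ.map Function.Embedding.inr)
      (by simpa using hS) x
    rw [← Equiv.sum_comp σ, Fintype.sum_sum_type] at hx
    refine ⟨σ, ?_⟩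
    rw [eq_neg_of_add_eq_zero_left hx, abs_neg, ← hσ, Finset.sum_map]
    rfl

lemma exists_isCompact_of_abs_exteriorGauge_le [Nonempty α] [Nonempty β]
    (hodd : Odd (Fintype.card (α ⊕ β))) (hp : 0 < p)
    (hpαβ : 2 * p = Fintype.card α ∨ 2 * p = Fintype.card β) (M : ℝ) :
    ∃ C C' : Set (SpecialLinearGroup (α ⊕ β) ℝ), IsCompact C ∧ IsCompact C' ∧
      ∀ g, |exteriorGauge p g| ≤ M →
        ∃ c ∈ C, ∃ h ∈ blockDiagonalSet α β, ∃ c' ∈ C', g = c * h * c' := by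
  have h2p : 2 * p ≤ Fintype.card (α ⊕ β) := by
    rw [Fintype.card_sum]; omega
  have hpι : p ≤ Fintype.card (α ⊕ β) := by omega
  obtain ⟨B, hB⟩ := exists_forall_abs_log_exteriorNorm_le hpι
  set R := M + 2 * (2 * (B + B)) + p * Real.log (Fintype.card (α ⊕ β)) with hR
  refine ⟨(fun q : SpecialLinearGroup (α ⊕ β) ℝ × ℝ => q.1 * unipotentMulScalar (0, q.2)) ''
    (specialOrthogonalSet (α ⊕ β) ×ˢ Icc (-R) R), specialOrthogonalSet (α ⊕ β),
    (isCompact_specialOrthogonalSet.prod isCompact_Icc).image ?_, isCompact_specialOrthogonalSet,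
    fun g hg => ?_⟩
  · exact continuous_fst.mul (continuous_unipotentMulScalar.comp
      (continuous_const.prodMk continuous_snd))
  obtain ⟨k, hk, l, hl, x, hx, hgx⟩ := exists_singular_value_decomposition hodd g
  obtain ⟨a, rfl⟩ : ∃ a, g = k * a * l := ⟨k⁻¹ * g * l⁻¹, by group⟩
  have ha : (a : Matrix (α ⊕ β) (α ⊕ β) ℝ) = diagonal fun i => Real.exp (x i) :=
    eq_of_coe_mul_mul_coe_eq hgx
  have hquasi {u v : SpecialLinearGroup (α ⊕ β) ℝ} (hv : v ∈ specialOrthogonalSet (α ⊕ β)) :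
      |exteriorGauge p (u * v) - exteriorGauge p u| ≤ 2 * (B + B) :=
    (abs_exteriorGauge_mul_sub_le hpι u v).trans (by
      gcongr
      exacts [hB v hv, hB _ (inv_mem_specialOrthogonalSet hv)])
  have hal : |exteriorGauge p (k * a * l) - exteriorGauge p (k * a)| ≤ 2 * (B + B) := hquasi hl
  have hka : |exteriorGauge p (k * a) - exteriorGauge p a| ≤ 2 * (B + B) := by
    have := hquasi (u := a⁻¹) (inv_mem_specialOrthogonalSet hk)
    rwa [← _root_.mul_inv_rev, exteriorGauge_inv, exteriorGauge_inv, neg_sub_neg,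
      abs_sub_comm] at this
  obtain ⟨S, hS, hSx⟩ := exists_abs_exteriorGauge_sub_sum_le hp h2p ha
  obtain ⟨σ, hσ⟩ := exists_perm_abs_sum_inl_eq (by rwa [hS]) hx
  obtain ⟨q, hq, hqd⟩ := exists_mul_diagonal_comp_perm hodd σ
  obtain ⟨d, rfl⟩ : ∃ d, a = q * d * q⁻¹ := ⟨q⁻¹ * a * q, by group⟩
  have hd : (d : Matrix (α ⊕ β) (α ⊕ β) ℝ) = diagonal fun i => Real.exp (x (σ i)) :=
    eq_of_coe_mul_mul_coe_eq (ha.trans (hqd _))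
  obtain ⟨h, hh, rfl⟩ := eq_unipotentMulScalar_mul_of_eq_diagonal hd
  refine ⟨_, ⟨(k * q, (∑ i, x (σ (Sum.inl i))) /
    (Fintype.card α * Fintype.card β)), ⟨mul_mem_specialOrthogonalSet hk hq, abs_le.1 ?_⟩, rfl⟩,
    h, hh,
    q⁻¹ * l, mul_mem_specialOrthogonalSet (inv_mem_specialOrthogonalSet hq) hl, ?_⟩
  rotate_left
  · simp only [_root_.mul_assoc]
  rw [abs_div, hσ]
  refine (div_le_self (abs_nonneg _) ?_).trans ?_
  · rw [abs_of_nonneg (by positivity)]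
    exact_mod_cast Nat.mul_pos Fintype.card_pos Fintype.card_pos
  rw [abs_le] at *
  constructor <;> linarith [hg.1, hg.2, hal.1, hal.2, hka.1, hka.2, hSx.1, hSx.2]

end Properness

section Transfer

open Set Topology

variable {m k : ℕ}

/-- The identification of Mathlib's special linear group with `SLblk m k`. -/
def specialLinearEquivSLblk (m k : ℕ) : SpecialLinearGroup (Fin m ⊕ Fin k) ℝ ≃ₜ* SLblk m k where
  toFun A := ⟨SpecialLinearGroup.toGL A, A.2⟩
  invFun A := ⟨A.val.val, A.2⟩
  left_inv _ := rfl
  right_inv _ := Subtype.ext (Units.ext rfl)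
  map_mul' A B := Subtype.ext (map_mul SpecialLinearGroup.toGL A B)
  continuous_toFun := SpecialLinearGroup.continuous_toGL.subtype_mk _
  continuous_invFun := (Units.continuous_val.comp continuous_subtype_val).subtype_mk _

lemma specialLinearEquivSLblk_mem_SLxSL_iff {h : SpecialLinearGroup (Fin m ⊕ Fin k) ℝ} :
    specialLinearEquivSLblk m k h ∈ SLxSL m k ↔ h ∈ blockDiagonalSet (Fin m) (Fin k) :=
  Iff.rfl

instance : PathConnectedSpace (SLblk m k) :=
  (specialLinearEquivSLblk m k).surjective.pathConnectedSpace
    (specialLinearEquivSLblk m k).continuous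

instance : LocallyCompactSpace (SLblk m k) :=
  have : LocallyCompactSpace (SpecialLinearGroup (Fin m ⊕ Fin k) ℝ) :=
    have : LocallyCompactSpace (Matrix (Fin m ⊕ Fin k) (Fin m ⊕ Fin k) ℝ) :=
      inferInstanceAs (LocallyCompactSpace (Fin m ⊕ Fin k → Fin m ⊕ Fin k → ℝ))
    SpecialLinearGroup.isClosedEmbedding_val.locallyCompactSpace
  (specialLinearEquivSLblk m k).symm.toHomeomorph.isClosedEmbedding.locallyCompactSpace

/-- The map induced by `blockCoordinates` on the homogeneous space. -/
def quotientBlockCoordinates (m k : ℕ) : SLblk m k ⧸ SLxSL m k → (Fin m → Fin k → ℝ) × ℝ :=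
  Quotient.lift (fun g => blockCoordinates ((specialLinearEquivSLblk m k).symm g))
    fun g g' hg => by
      have h := blockCoordinates_mul ((specialLinearEquivSLblk m k).symm g)
        (h := (specialLinearEquivSLblk m k).symm (g⁻¹ * g')) (by
          rw [← specialLinearEquivSLblk_mem_SLxSL_iff, ContinuousMulEquiv.apply_symm_apply]
          exact QuotientGroup.leftRel_apply.1 hg)
      rw [← map_mul, mul_inv_cancel_left] at h
      exact h.symm

lemma continuous_quotientBlockCoordinates : Continuous (quotientBlockCoordinates m k) :=
  (continuous_blockCoordinates.comp (specialLinearEquivSLblk m k).symm.continuous).quotient_lift _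

lemma quotientBlockCoordinates_unipotentMulScalar [Nonempty (Fin m)] [Nonempty (Fin k)]
    (e : (Fin m → Fin k → ℝ) × ℝ) : quotientBlockCoordinates m k
      (specialLinearEquivSLblk m k (unipotentMulScalar e) : SLblk m k) = e :=
  blockCoordinates_unipotentMulScalar e

lemma one_lt_rank_blockCoordinates [Nonempty (Fin m)] [Nonempty (Fin k)] :
    1 < Module.rank ℝ ((Fin m → Fin k → ℝ) × ℝ) := by
  rw [← Module.finrank_eq_rank, Module.finrank_prod, Module.finrank_pi_fintype]
  simp only [Module.finrank_fin_fun, Module.finrank_self, Finset.sum_const, Finset.card_univ,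
    smul_eq_mul]
  exact_mod_cast Nat.lt_add_of_pos_left (Nat.mul_pos Fintype.card_pos (Fin.pos_iff_nonempty.2 ‹_›))

lemma noncompactSpace_SLblk_quotient [Nonempty (Fin m)] [Nonempty (Fin k)] :
    NoncompactSpace (SLblk m k ⧸ SLxSL m k) :=
  noncompactSpace_quotient _ _ _ continuous_quotientBlockCoordinates
    quotientBlockCoordinates_unipotentMulScalar

lemma oneEnded_SLblk_quotient [Nonempty (Fin m)] [Nonempty (Fin k)] :
    OneEnded (SLblk m k ⧸ SLxSL m k) := by
  refine oneEnded_quotient _ _ _ one_lt_rank_blockCoordinates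
    (isCompact_specialOrthogonalSet.image (specialLinearEquivSLblk m k).continuous)
    ⟨1, ?_, map_one (specialLinearEquivSLblk m k)⟩
    ((specialLinearEquivSLblk m k).continuous.comp continuous_unipotentMulScalar)
    continuous_quotientBlockCoordinates quotientBlockCoordinates_unipotentMulScalar fun g => ?_
  · simp [specialOrthogonalSet]
  · obtain ⟨g, rfl⟩ := (specialLinearEquivSLblk m k).surjective g
    obtain ⟨κ, hκ, e, h, hh, rfl⟩ := exists_specialOrthogonal_mul_unipotentMulScalar_mul g
    exact ⟨_, ⟨κ, hκ, rfl⟩, e, _, specialLinearEquivSLblk_mem_SLxSL_iff.2 hh, by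
      rw [map_mul, map_mul]; rfl⟩

end Transfer

/-- **No compact Clifford–Klein forms for `SL(n,ℝ)/(SL(m,ℝ) × SL(n−m,ℝ))`, `n` odd.**
If `0 < m < n` and `n` is odd, there is no discrete subgroup `Γ` of `G = SL(n,ℝ)` acting
properly discontinuously and cocompactly on the homogeneous space `G/H`,
where `H` is the standard block-diagonal copy of `SL(m,ℝ) × SL(n−m,ℝ)`. -/
theorem no_compact_CliffordKlein_form_SL_SLxSL (m n : ℕ) (h0m : 0 < m) (hmn : m < n)
    (hodd : Odd n) :
    ¬ ∃ Γ : Subgroup ↥(SLblk m (n - m)), DiscreteTopology ↥Γ ∧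
      ProperlyDiscontinuousSMul ↥Γ (↥(SLblk m (n - m)) ⧸ SLxSL m (n - m)) ∧
      CompactSpace (MulAction.orbitRel.Quotient ↥Γ
        (↥(SLblk m (n - m)) ⧸ SLxSL m (n - m))) := by
  obtain ⟨k, rfl⟩ : ∃ k, n = m + k := ⟨n - m, by omega⟩
  rw [Nat.add_sub_cancel_left]
  rintro ⟨Γ, -, hΓ, hcompact⟩
  have : Nonempty (Fin m) := Fin.pos_iff_nonempty.1 h0m
  have : Nonempty (Fin k) := Fin.pos_iff_nonempty.1 (by omega)
  have : NoncompactSpace (SLblk m k ⧸ SLxSL m k) := noncompactSpace_SLblk_quotient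
  obtain ⟨p, hp, hpmk⟩ : ∃ p, 0 < p ∧ (2 * p = m ∨ 2 * p = k) := by
    obtain ⟨r, hr⟩ := hodd
    obtain ⟨q, rfl | rfl⟩ := m.even_or_odd'
    · exact ⟨q, by omega, .inl rfl⟩
    · exact ⟨r - q, by omega, .inr (by omega)⟩
  have hpcard : p ≤ Fintype.card (Fin m ⊕ Fin k) := by
    simp only [Fintype.card_sum, Fintype.card_fin]; omega
  let φ := specialLinearEquivSLblk m k
  refine not_compactSpace_orbitRel_quotient (SLxSL m k) oneEnded_SLblk_quotient
    (fun g => exteriorGauge p (φ.symm g)) (fun g => ?_) (fun h => ?_) (fun M => ?_)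
    Γ hcompact
  · rw [map_inv, exteriorGauge_inv]
  · simp only [map_mul]
    exact ⟨_, fun g => abs_exteriorGauge_mul_sub_le hpcard _ _⟩
  · obtain ⟨C, C', hC, hC', hM⟩ := exists_isCompact_of_abs_exteriorGauge_le
      (α := Fin m) (β := Fin k) (by simpa using hodd) hp (by simpa using hpmk) M
    refine ⟨φ '' C, φ '' C', hC.image φ.continuous, hC'.image φ.continuous, fun g hg => ?_⟩
    obtain ⟨c, hc, h, hh, c', hc', hg⟩ := hM _ hg
    refine ⟨_, ⟨c, hc, rfl⟩, φ h, specialLinearEquivSLblk_mem_SLxSL_iff.2 hh, _, ⟨c', hc', rfl⟩, ?_⟩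
    rw [← map_mul, ← map_mul, ← hg, ContinuousMulEquiv.apply_symm_apply]
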